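/- Let q = 3, n = 2, and k = 𝔽_3(θ) the rational function field over 𝔽_3. Consider the two points P_1 = (0, θ²+1) and P_2 = (0, θ^{−1}) in C^{⊗2}(k). Then P_1 and P_2 are linearly independent over 𝔽_3[t]: if a_1·P_1 + a_2·P_2 = 0 in C^{⊗2}(k) with a_1, a_2 ∈ 𝔽_3[t], then a_1 = a_2 = 0. -/

import Mathlib

open Polynomial

/-- The `t`-action `φ` on the `n`-th tensor power of the Carlitz module:
`φ(x_1,…,x_n) = (θx_1+x_2, …, θx_{n−1}+x_n, θx_n + x_1^q)`. -/
def carlitzPhi {L : Type*} [Field L] (q n : ℕ) (θ : L) (x : Fin n → L) : Fin n → L :=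
  fun i => θ * x i +
    if h : (i : ℕ) + 1 < n then x ⟨(i : ℕ) + 1, h⟩
    else (x ⟨0, Nat.lt_of_le_of_lt (Nat.zero_le _) i.isLt⟩) ^ q

/-- The action of `a ∈ 𝔽_q[t]` on `C^{⊗n}(L)`, namely `a(φ)` applied to `x`; the
coefficients of `a` act through the ring homomorphism `χ : Fq →+* L`. -/
def carlitzAct {Fq L : Type*} [Field Fq] [Field L] (q n : ℕ) (θ : L) (χ : Fq →+* L)
    (a : Polynomial Fq) (x : Fin n → L) : Fin n → L :=
  ∑ i ∈ Finset.range (a.natDegree + 1), χ (a.coeff i) • (carlitzPhi q n θ)^[i] x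


section helpers
variable {L Γ : Type*} [Field L] [LinearOrderedCommGroupWithZero Γ]

theorem cp_zero (θ : L) (x : Fin 2 → L) : carlitzPhi 3 2 θ x 0 = θ * x 0 + x 1 := by
  simp [carlitzPhi]

theorem cp_one (θ : L) (x : Fin 2 → L) : carlitzPhi 3 2 θ x 1 = θ * x 1 + x 0 ^ 3 := by
  simp [carlitzPhi]

theorem val_chi (v : Valuation L Γ) (χ : ZMod 3 →+* L) (c : ZMod 3) (hc : c ≠ 0) :
    v (χ c) = 1 := by
  have h2 : c ^ 2 = 1 := by revert hc; revert c; decide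
  have : v (χ c) ^ 2 = 1 := by rw [← map_pow, ← map_pow, h2, map_one, map_one]
  exact (pow_eq_one_iff_of_nonneg zero_le (two_ne_zero : (2 : ℕ) ≠ 0)).1 this

theorem val_chi_le (v : Valuation L Γ) (χ : ZMod 3 →+* L) (c : ZMod 3) :
    v (χ c) ≤ 1 := by
  by_cases hc : c = 0
  · simp [hc]
  · exact (val_chi v χ c hc).le

theorem act_apply (θ : L) (χ : ZMod 3 →+* L) (a : Polynomial (ZMod 3)) (x : Fin 2 → L) (m : Fin 2) :
    carlitzAct 3 2 θ χ a x m =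
      ∑ i ∈ Finset.range a.natDegree, χ (a.coeff i) * (carlitzPhi 3 2 θ)^[i] x m
        + χ (a.coeff a.natDegree) * (carlitzPhi 3 2 θ)^[a.natDegree] x m := by
  simp [carlitzAct, Finset.sum_apply, Finset.sum_range_succ]

theorem integral_iter (v : Valuation L Γ) (θ : L) (hθ : v θ ≤ 1) (x : Fin 2 → L)
    (hx : ∀ m, v (x m) ≤ 1) (i : ℕ) : ∀ m, v ((carlitzPhi 3 2 θ)^[i] x m) ≤ 1 := by
  induction i with
  | zero => simpa using hx
  | succ i ih =>
    rw [Function.iterate_succ_apply']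
    set y := (carlitzPhi 3 2 θ)^[i] x
    intro m
    fin_cases m
    · show v (carlitzPhi 3 2 θ y 0) ≤ 1
      rw [cp_zero]
      refine v.map_add_le ?_ (ih 1)
      rw [map_mul]; exact mul_le_one' hθ (ih 0)
    · show v (carlitzPhi 3 2 θ y 1) ≤ 1
      rw [cp_one]
      refine v.map_add_le ?_ ?_
      · rw [map_mul]; exact mul_le_one' hθ (ih 1)
      · rw [map_pow]; exact pow_le_one' (ih 0) 3

theorem integral_act (v : Valuation L Γ) (θ : L) (hθ : v θ ≤ 1) (χ : ZMod 3 →+* L)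
    (a : Polynomial (ZMod 3)) (x : Fin 2 → L)
    (hx : ∀ m, v (x m) ≤ 1) (m : Fin 2) : v (carlitzAct 3 2 θ χ a x m) ≤ 1 := by
  rw [act_apply]
  refine v.map_add_le (v.map_sum_le fun i _ => ?_) ?_ <;>
  · rw [map_mul]; exact mul_le_one' (val_chi_le _ _ _) (integral_iter v θ hθ x hx _ m)

/-- pole orders of the iterates of `P_2` -/
theorem iter_pole (v : Valuation L Γ) (θ : L) (h0 : θ ≠ 0) (hθ : v θ < 1) (j : ℕ) :
    (v ((carlitzPhi 3 2 θ)^[2 * j] ![0, θ⁻¹] 1) = v θ⁻¹ ^ (3 ^ j) ∧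
      v ((carlitzPhi 3 2 θ)^[2 * j] ![0, θ⁻¹] 0) ^ 3 < v θ⁻¹ ^ (3 ^ j)) ∧
    (v ((carlitzPhi 3 2 θ)^[2 * j + 1] ![0, θ⁻¹] 0) = v θ⁻¹ ^ (3 ^ j) ∧
      v ((carlitzPhi 3 2 θ)^[2 * j + 1] ![0, θ⁻¹] 1) < v θ⁻¹ ^ (3 ^ j)) := by
  have hr0 : 0 < v θ := zero_lt_iff.2 (v.ne_zero_iff.2 h0)
  have hr : 1 < v θ⁻¹ := by rw [map_inv₀]; exact (one_lt_inv₀ hr0).2 hθ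
  set r := v θ⁻¹ with hrdef
  have hrj : ∀ j : ℕ, 0 < r ^ (3 ^ j) := fun j => pow_pos (zero_lt_one.trans hr) _
  have small : ∀ z : L, ∀ b : Γ, 0 < b → v z ≤ b → v (θ * z) < b := by
    intro z b hb hz
    rw [map_mul]
    calc v θ * v z ≤ v θ * b := by gcongr
      _ < 1 * b := by gcongr
      _ = b := one_mul b
  have step : ∀ (j : ℕ) (y : Fin 2 → L), v (y 1) = r ^ (3 ^ j) → v (y 0) ^ 3 < r ^ (3 ^ j) →
      v (carlitzPhi 3 2 θ y 0) = r ^ (3 ^ j) ∧ v (carlitzPhi 3 2 θ y 1) < r ^ (3 ^ j) := by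
    intro j y h1 h3
    have h1r : 1 ≤ r ^ (3 ^ j) := one_le_pow₀ hr.le
    have hy0 : v (y 0) < r ^ (3 ^ j) := by
      by_contra! hc
      have : v (y 0) ≤ v (y 0) ^ 3 := le_self_pow₀ (h1r.trans hc) (by norm_num)
      exact absurd (hc.trans this) (not_le.2 h3)
    rw [cp_zero, cp_one]
    constructor
    · rw [Valuation.map_add_eq_of_lt_right, h1]
      rw [h1]; exact small _ _ (hrj j) hy0.le
    · refine v.map_add_lt (small _ _ (hrj j) h1.le) ?_
      rwa [map_pow]
  have step2 : ∀ (j : ℕ) (y : Fin 2 → L), v (y 0) = r ^ (3 ^ j) → v (y 1) < r ^ (3 ^ j) →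
      v (carlitzPhi 3 2 θ y 1) = r ^ (3 ^ (j+1)) ∧
      v (carlitzPhi 3 2 θ y 0) ^ 3 < r ^ (3 ^ (j+1)) := by
    intro j y h1 h3
    have e : r ^ (3 ^ (j+1)) = (r ^ (3 ^ j)) ^ 3 := by rw [pow_succ, pow_mul]
    have h1r : 1 ≤ r ^ (3 ^ j) := one_le_pow₀ hr.le
    rw [cp_zero, cp_one, e]
    constructor
    · rw [Valuation.map_add_eq_of_lt_right, map_pow, h1]
      rw [map_pow, h1]
      exact (small _ _ (hrj j) h3.le).trans_le (le_self_pow₀ h1r (by norm_num))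
    · refine pow_lt_pow_left₀ ?_ zero_le (by norm_num)
      exact v.map_add_lt (small _ _ (hrj j) h1.le) h3
  induction j with
  | zero =>
    have hb := step 0 ![0, θ⁻¹] (by simp [hrdef]) (by simpa using hrj 0)
    refine ⟨⟨by simp [hrdef], by simpa using hrj 0⟩, ?_⟩
    simpa using hb
  | succ j ih =>
    have hb := step2 j _ ih.2.1 ih.2.2
    rw [← Function.iterate_succ_apply' (carlitzPhi 3 2 θ)] at hb
    have hc := step (j+1) _ hb.1 hb.2
    rw [← Function.iterate_succ_apply' (carlitzPhi 3 2 θ)] at hc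
    exact ⟨hb, hc⟩

theorem part_two (v : Valuation L Γ) (θ : L) (h0 : θ ≠ 0) (hθ : v θ < 1) (χ : ZMod 3 →+* L)
    (a : Polynomial (ZMod 3)) (y : Fin 2 → L) (hy : ∀ m, v (y m) ≤ 1)
    (h : y + carlitzAct 3 2 θ χ a ![0, θ⁻¹] = 0) : a = 0 := by
  by_contra ha
  have hr0 : 0 < v θ := zero_lt_iff.2 (v.ne_zero_iff.2 h0)
  have hr : 1 < v θ⁻¹ := by rw [map_inv₀]; exact (one_lt_inv₀ hr0).2 hθ
  have hp := iter_pole v θ h0 hθ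
  set r := v θ⁻¹ with hrdef
  have h1r : ∀ j : ℕ, 1 < r ^ (3 ^ j) := fun j => one_lt_pow₀ hr (by positivity)
  have hlead : v (χ (a.coeff a.natDegree)) = 1 :=
    val_chi _ _ _ (by simpa using ha)
  have key : ∀ (m : Fin 2) (b : Γ), 1 < b → v ((carlitzPhi 3 2 θ)^[a.natDegree] ![0, θ⁻¹] m) = b →
      (∀ i < a.natDegree, v ((carlitzPhi 3 2 θ)^[i] ![0, θ⁻¹] m) < b) → False := by
    intro m b hb hd hl
    have hm := congrFun h m
    rw [Pi.add_apply, act_apply, ← add_assoc, Pi.zero_apply] at hm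
    have h2 := eq_neg_of_add_eq_zero_right hm
    have h3 := congrArg v h2
    rw [Valuation.map_neg, map_mul, hlead, one_mul, hd] at h3
    have h4 : v (y m + ∑ i ∈ Finset.range a.natDegree,
        χ (a.coeff i) * (carlitzPhi 3 2 θ)^[i] ![0, θ⁻¹] m) < b := by
      refine v.map_add_lt ((hy m).trans_lt hb) (v.map_sum_lt (zero_lt_one.trans hb).ne' ?_)
      intro i hi
      rw [map_mul]
      exact (mul_le_of_le_one_left' (val_chi_le v χ _)).trans_lt (hl i (Finset.mem_range.1 hi))
    exact absurd h3 h4.ne'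
  have hz : ∀ j, v ((carlitzPhi 3 2 θ)^[2 * j] ![0, θ⁻¹] 0) < r ^ (3 ^ j) := by
    intro j
    by_contra! hc
    have : _ ≤ v ((carlitzPhi 3 2 θ)^[2 * j] ![0, θ⁻¹] 0) ^ 3 :=
      le_self_pow₀ ((h1r j).le.trans hc) (by norm_num)
    exact absurd (hc.trans this) (not_le.2 (hp j).1.2)
  have hmono : ∀ i j, i < j → r ^ (3 ^ i) < r ^ (3 ^ j) := fun i j hij =>
    pow_lt_pow_right₀ hr (Nat.pow_lt_pow_right (by norm_num) hij)
  rcases Nat.even_or_odd' a.natDegree with ⟨j, hj | hj⟩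
  · refine key 1 (r ^ (3 ^ j)) (h1r j) (by rw [hj]; exact (hp j).1.1) ?_
    intro i hi
    rcases Nat.even_or_odd' i with ⟨l, hl | hl⟩ <;> have hlj := hmono l j (by omega) <;> rw [hl]
    · rwa [(hp l).1.1]
    · exact (hp l).2.2.trans hlj
  · refine key 0 (r ^ (3 ^ j)) (h1r j) (by rw [hj]; exact (hp j).2.1) ?_
    intro i hi
    rcases Nat.even_or_odd' i with ⟨l, hl | hl⟩ <;> rw [hl]
    · rcases (show l < j ∨ l = j by omega) with h' | h'
      · exact (hz l).trans (hmono l j h')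
      · rw [← h']; exact hz l
    · rw [(hp l).2.1]; exact hmono l j (by omega)

/-- degrees of the iterates of `P_1` -/
theorem iter_deg (v : Valuation L Γ) (θ : L) (hθ : 1 < v θ) (htwo : v 2 = 1) (j : ℕ) :
    (v ((carlitzPhi 3 2 θ)^[2 * j + 2] ![0, θ ^ 2 + 1] 0) = v θ ^ (3 ^ (j + 1)) ∧
      v ((carlitzPhi 3 2 θ)^[2 * j + 2] ![0, θ ^ 2 + 1] 1) = v θ ^ (2 * 3 ^ (j + 1))) ∧
    (v ((carlitzPhi 3 2 θ)^[2 * j + 3] ![0, θ ^ 2 + 1] 0) = v θ ^ (2 * 3 ^ (j + 1)) ∧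
      v ((carlitzPhi 3 2 θ)^[2 * j + 3] ![0, θ ^ 2 + 1] 1) = v θ ^ (3 ^ (j + 2))) := by
  have lt : ∀ m n : ℕ, m < n → v θ ^ m < v θ ^ n := fun m n h => pow_lt_pow_right₀ hθ h
  have step : ∀ (j : ℕ) (y : Fin 2 → L), v (y 0) = v θ ^ (3 ^ (j+1)) →
      v (y 1) = v θ ^ (2 * 3 ^ (j+1)) →
      v (carlitzPhi 3 2 θ y 0) = v θ ^ (2 * 3 ^ (j+1)) ∧
      v (carlitzPhi 3 2 θ y 1) = v θ ^ (3 ^ (j+2)) := by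
    intro j y h0 h1
    have hj : 1 ≤ 3 ^ j := Nat.one_le_pow _ _ (by norm_num)
    rw [cp_zero, cp_one]
    constructor
    · rw [Valuation.map_add_eq_of_lt_right, h1]
      rw [map_mul, h0, h1, ← pow_succ']; apply lt; rw [pow_succ]; omega
    · rw [Valuation.map_add_eq_of_lt_right, map_pow, h0, ← pow_mul, ← pow_succ]
      rw [map_mul, map_pow, h0, h1, ← pow_succ', ← pow_mul]; apply lt; rw [pow_succ]; omega
  have step2 : ∀ (j : ℕ) (y : Fin 2 → L), v (y 0) = v θ ^ (2 * 3 ^ (j+1)) →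
      v (y 1) = v θ ^ (3 ^ (j+2)) →
      v (carlitzPhi 3 2 θ y 0) = v θ ^ (3 ^ (j+2)) ∧
      v (carlitzPhi 3 2 θ y 1) = v θ ^ (2 * 3 ^ (j+2)) := by
    intro j y h0 h1
    have hj : 1 ≤ 3 ^ j := Nat.one_le_pow _ _ (by norm_num)
    rw [cp_zero, cp_one]
    constructor
    · rw [Valuation.map_add_eq_of_lt_right, h1]
      rw [map_mul, h0, h1, ← pow_succ']; apply lt; rw [pow_succ, pow_succ]; omega
    · have e : 2 * 3 ^ (j + 2) = 2 * 3 ^ (j+1) * 3 := by ring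
      rw [Valuation.map_add_eq_of_lt_right, map_pow, h0, ← pow_mul, e]
      rw [map_mul, map_pow, h0, h1, ← pow_succ', ← pow_mul]; apply lt; rw [pow_succ, pow_succ]; omega
  induction j with
  | zero =>
    have hq : v (θ ^ 2 + 1) = v θ ^ 2 := by
      rw [Valuation.map_add_eq_of_lt_left, map_pow]
      rw [map_one, map_pow]; exact one_lt_pow₀ hθ (by norm_num)
    have hb : v ((carlitzPhi 3 2 θ)^[2] ![0, θ ^ 2 + 1] 0) = v θ ^ (3 ^ (0 + 1)) ∧
      v ((carlitzPhi 3 2 θ)^[2] ![0, θ ^ 2 + 1] 1) = v θ ^ (2 * 3 ^ (0 + 1)) := by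
      simp only [Function.iterate_succ_apply', Function.iterate_zero, id, cp_zero, cp_one]
      simp only [Matrix.cons_val_zero, Matrix.cons_val_one]
      constructor
      · rw [show θ * (θ * 0 + (θ ^ 2 + 1)) + (θ * (θ ^ 2 + 1) + 0 ^ 3) = 2 * (θ * (θ ^ 2 + 1)) by
          ring, map_mul, map_mul, hq, htwo, one_mul, ← pow_succ']
        norm_num
      · rw [show θ * (θ * (θ ^ 2 + 1) + 0 ^ 3) + (θ * 0 + (θ ^ 2 + 1)) ^ 3
          = θ * (θ * (θ ^ 2 + 1)) + (θ ^ 2 + 1) ^ 3 by ring]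
        rw [Valuation.map_add_eq_of_lt_right, map_pow, hq, ← pow_mul]
        · norm_num
        rw [map_mul, map_mul, map_pow, hq, ← pow_mul, ← pow_succ', ← pow_succ']
        apply lt; norm_num
    have hc := step 0 _ hb.1 hb.2
    rw [← Function.iterate_succ_apply' (carlitzPhi 3 2 θ)] at hc
    exact ⟨hb, hc⟩
  | succ j ih =>
    have hb := step2 j _ ih.2.1 ih.2.2
    rw [← Function.iterate_succ_apply' (carlitzPhi 3 2 θ)] at hb
    have hc := step (j+1) _ hb.1 hb.2
    rw [← Function.iterate_succ_apply' (carlitzPhi 3 2 θ)] at hc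
    exact ⟨hb, hc⟩

theorem deg_mono (v : Valuation L Γ) (θ : L) (hθ : 1 < v θ) (htwo : v 2 = 1) :
    StrictMono fun i => v ((carlitzPhi 3 2 θ)^[i] ![0, θ ^ 2 + 1] 1) := by
  have hd := iter_deg v θ hθ htwo
  have lt : ∀ m n : ℕ, m < n → v θ ^ m < v θ ^ n := fun m n h => pow_lt_pow_right₀ hθ h
  have hq : v (θ ^ 2 + 1) = v θ ^ 2 := by
    rw [Valuation.map_add_eq_of_lt_left, map_pow]
    rw [map_one, map_pow]; exact one_lt_pow₀ hθ (by norm_num)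
  have e0 : v ((carlitzPhi 3 2 θ)^[0] ![0, θ ^ 2 + 1] 1) = v θ ^ 2 := by simpa using hq
  have e1 : v ((carlitzPhi 3 2 θ)^[1] ![0, θ ^ 2 + 1] 1) = v θ ^ 3 := by
    simp [cp_one, hq]; rw [← pow_succ']
  have e2 := (hd 0).1.2
  refine strictMono_nat_of_lt_succ fun i => ?_
  show v ((carlitzPhi 3 2 θ)^[i] ![0, θ ^ 2 + 1] 1) < v ((carlitzPhi 3 2 θ)^[i+1] ![0, θ ^ 2 + 1] 1)
  match i with
  | 0 => rw [e0, e1]; exact lt _ _ (by norm_num)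
  | 1 => rw [e1, e2]; exact lt _ _ (by norm_num)
  | i + 2 =>
    rcases Nat.even_or_odd' i with ⟨j, hj | hj⟩ <;> subst hj
    · have hj : 1 ≤ 3 ^ j := Nat.one_le_pow _ _ (by norm_num)
      rw [(hd j).1.2, (hd j).2.2]; apply lt; rw [pow_succ, pow_succ]; omega
    · have hj : 1 ≤ 3 ^ j := Nat.one_le_pow _ _ (by norm_num)
      have := (hd (j+1)).1.2
      rw [show 2 * j + 1 + 2 + 1 = 2 * (j + 1) + 2 by ring, this,
        show 2 * j + 1 + 2 = 2 * j + 3 by ring, (hd j).2.2]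
      apply lt; rw [pow_succ, pow_succ]; omega

theorem part_one (v : Valuation L Γ) (θ : L) (hθ : 1 < v θ) (χ : ZMod 3 →+* L)
    (a : Polynomial (ZMod 3)) (h : carlitzAct 3 2 θ χ a ![0, θ ^ 2 + 1] = 0) : a = 0 := by
  by_contra ha
  have htwo : v 2 = 1 := by
    have := val_chi v χ 2 (by decide)
    rwa [show (2 : ZMod 3) = 1 + 1 by decide, map_add, map_one, one_add_one_eq_two] at this
  have hm := deg_mono v θ hθ htwo
  have hlead : v (χ (a.coeff a.natDegree)) = 1 := val_chi _ _ _ (by simpa using ha)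
  have h1 := congrFun h 1
  rw [act_apply, Pi.zero_apply] at h1
  have h3 := congrArg v (eq_neg_of_add_eq_zero_right h1)
  rw [Valuation.map_neg, map_mul, hlead, one_mul] at h3
  have hpos : v ((carlitzPhi 3 2 θ)^[a.natDegree] ![0, θ ^ 2 + 1] 1) ≠ 0 := by
    have h0 : 0 < v ((carlitzPhi 3 2 θ)^[0] ![0, θ ^ 2 + 1] 1) := by
      simp only [Function.iterate_zero, id, Matrix.cons_val_one, Matrix.cons_val_zero]
      rw [Valuation.map_add_eq_of_lt_left, map_pow]
      · exact pow_pos (zero_lt_one.trans hθ) _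
      · rw [map_one, map_pow]; exact one_lt_pow₀ hθ (by norm_num)
    exact (h0.trans_le (hm.monotone (Nat.zero_le _))).ne'
  refine absurd h3 (ne_of_gt (v.map_sum_lt hpos ?_))
  intro i hi
  rw [map_mul]
  exact (mul_le_of_le_one_left' (val_chi_le v χ _)).trans_lt (hm (Finset.mem_range.1 hi))

end helpers

/-- The points `P_1 = (0, θ²+1)` and `P_2 = (0, θ^{−1})` of `C^{⊗2}(𝔽_3(θ))` are linearly
independent over `𝔽_3[t]`. -/
theorem example_points_independent
    (a₁ a₂ : Polynomial (ZMod 3))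
    (h : carlitzAct 3 2 (RatFunc.X : RatFunc (ZMod 3)) (algebraMap (ZMod 3) (RatFunc (ZMod 3)))
          a₁ ![0, RatFunc.X ^ 2 + 1] +
        carlitzAct 3 2 (RatFunc.X : RatFunc (ZMod 3)) (algebraMap (ZMod 3) (RatFunc (ZMod 3)))
          a₂ ![0, (RatFunc.X)⁻¹] = 0) :
    a₁ = 0 ∧ a₂ = 0 := by
  classical
  have hX0 : (RatFunc.X : RatFunc (ZMod 3)) ≠ 0 := RatFunc.X_ne_zero
  have hv : (Polynomial.idealX (ZMod 3)).valuation (RatFunc (ZMod 3)) RatFunc.X < 1 := by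
    rw [Polynomial.valuation_X_eq_neg_one, ← WithZero.exp_zero, WithZero.exp_lt_exp]
    norm_num
  have h2 : a₂ = 0 := by
    refine part_two ((Polynomial.idealX (ZMod 3)).valuation (RatFunc (ZMod 3))) _ hX0 hv _ a₂ _
      (integral_act _ _ hv.le _ a₁ _ ?_) h
    intro m
    fin_cases m
    · simp
    · show (Polynomial.idealX (ZMod 3)).valuation (RatFunc (ZMod 3)) (RatFunc.X ^ 2 + 1) ≤ 1
      refine Valuation.map_add_le _ ?_ (by simp)
      rw [map_pow]; exact pow_le_one' hv.le 2
  refine ⟨?_, h2⟩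
  subst h2
  refine part_one (RatFunc.inftyValuation (ZMod 3)) RatFunc.X ?_
    (algebraMap (ZMod 3) (RatFunc (ZMod 3))) a₁ ?_
  · rw [RatFunc.inftyValuation.X, ← WithZero.exp_zero, WithZero.exp_lt_exp]
    norm_num
  · simpa [carlitzAct] using h
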